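/- arXiv:2012.13606 — 3 statements merged into one kernel-verified Lean document; each statement's English description precedes it below -/
import Mathlib

section
/- Let N be a graded generalized 2-absorbing (graded G2-absorbing) submodule of M and let I be a graded ideal of R with h-component I_h = I ∩ R_h. If r ∈ R is homogeneous, m ∈ M is homogeneous, h ∈ G, and r·i·m ∈ N for every i ∈ I_h, then either r^n·m ∈ N for some n ≥ 1, or for every i ∈ I_h there exists n ≥ 1 with i^n·m ∈ N, or for every i ∈ I_h one has (r·i)·M ⊆ N. -/
/-- A submodule `N` of a `G`-graded module `M` (with grading `ℳ`) is a *graded submodule*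
if it contains all homogeneous components of its elements. -/
def Submodule.IsGradedSub {G R M : Type*} [AddCommGroup G] [DecidableEq G] [CommRing R]
    [AddCommGroup M] [Module R M] (ℳ : G → AddSubgroup M) [DirectSum.Decomposition ℳ]
    (N : Submodule R M) : Prop :=
  ∀ (g : G) (m : M), m ∈ N → (DirectSum.decompose ℳ m g : M) ∈ N

/-- A graded generalized 2-absorbing (graded G2-absorbing) submodule: a proper graded
submodule `N` such that whenever `r, s ∈ h(R)` and `m ∈ h(M)` with `r·s·m ∈ N`, either
`r^k·m ∈ N` for some `k ≥ 1`, or `s^k·m ∈ N` for some `k ≥ 1`, or `r·s·M ⊆ N`. -/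
def IsGradedG2Absorbing {G R M : Type*} [AddCommGroup G] [DecidableEq G] [CommRing R]
    [AddCommGroup M] [Module R M] (𝒜 : G → AddSubgroup R) (ℳ : G → AddSubgroup M)
    [GradedRing 𝒜] [DirectSum.Decomposition ℳ] [SetLike.GradedSMul 𝒜 ℳ]
    (N : Submodule R M) : Prop :=
  N ≠ ⊤ ∧ Submodule.IsGradedSub ℳ N ∧
    ∀ r s : R, SetLike.IsHomogeneousElem 𝒜 r → SetLike.IsHomogeneousElem 𝒜 s →
      ∀ m : M, SetLike.IsHomogeneousElem ℳ m → r • s • m ∈ N →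
        (∃ k : ℕ, 1 ≤ k ∧ r ^ k • m ∈ N) ∨ (∃ k : ℕ, 1 ≤ k ∧ s ^ k • m ∈ N) ∨
          ∀ x : M, (r * s) • x ∈ N

theorem stmt0 {G R M : Type*} [AddCommGroup G] [DecidableEq G] [CommRing R]
    [AddCommGroup M] [Module R M] (𝒜 : G → AddSubgroup R) (ℳ : G → AddSubgroup M)
    [GradedRing 𝒜] [DirectSum.Decomposition ℳ] [SetLike.GradedSMul 𝒜 ℳ]
    (N : Submodule R M) (hN : IsGradedG2Absorbing 𝒜 ℳ N)
    (I : Ideal R) (hI : Ideal.IsHomogeneous 𝒜 I)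
    (r : R) (hr : SetLike.IsHomogeneousElem 𝒜 r)
    (m : M) (hm : SetLike.IsHomogeneousElem ℳ m) (h : G)
    (hmul : ∀ i ∈ I, i ∈ 𝒜 h → r • i • m ∈ N) :
    (∃ n : ℕ, 1 ≤ n ∧ r ^ n • m ∈ N) ∨
      (∀ i ∈ I, i ∈ 𝒜 h → ∃ n : ℕ, 1 ≤ n ∧ i ^ n • m ∈ N) ∨
      (∀ i ∈ I, i ∈ 𝒜 h → ∀ x : M, (r * i) • x ∈ N) := by
  obtain ⟨-, -, hab⟩ := hN
  by_cases h1 : ∃ n : ℕ, 1 ≤ n ∧ r ^ n • m ∈ N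
  · exact Or.inl h1
  right
  let J : Ideal R := (N.comap (LinearMap.toSpanSingleton R M m) : Submodule R R)
  have hJ : ∀ a : R, a ∈ J.radical ↔ ∃ n : ℕ, 1 ≤ n ∧ a ^ n • m ∈ N := by
    intro a
    constructor
    · rintro ⟨n, hn⟩
      have hn' : a ^ n • m ∈ N := hn
      refine ⟨n + 1, by omega, ?_⟩
      rw [pow_succ', mul_smul]
      exact N.smul_mem _ hn'
    · rintro ⟨n, -, hn⟩
      exact ⟨n, hn⟩
  have key : ∀ i ∈ I, i ∈ 𝒜 h → i ∈ J.radical ∨ ∀ x : M, (r * i) • x ∈ N := by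
    intro i hi hih
    rcases hab r i hr ⟨h, hih⟩ m hm (hmul i hi hih) with h2 | h2 | h2
    · exact absurd h2 h1
    · exact Or.inl ((hJ i).2 h2)
    · exact Or.inr h2
  by_contra hcon
  rw [not_or] at hcon
  obtain ⟨hA, hB⟩ := hcon
  apply hA
  intro i hi hih
  rw [← hJ]
  by_contra hiA
  apply hB
  intro j hj hjh
  have hiB := (key i hi hih).resolve_left hiA
  rcases key j hj hjh with hjA | hjB
  · rcases key (i + j) (I.add_mem hi hj) ((𝒜 h).add_mem hih hjh) with h3 | h3
    · exact absurd ((Ideal.add_mem_iff_left _ hjA).1 h3) hiA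
    · intro x
      have h4 := N.sub_mem (h3 x) (hiB x)
      rwa [← sub_smul, ← mul_sub, add_sub_cancel_left] at h4
  · exact hjB
end

section
/- Let N be a graded generalized 2-absorbing (graded G2-absorbing) submodule of M and let J and I be graded ideals of R with components J_g = J ∩ R_g and I_h = I ∩ R_h. If m ∈ M is homogeneous, g, h ∈ G, and j·i·m ∈ N for all j ∈ J_g and i ∈ I_h, then either for every j ∈ J_g there exists n ≥ 1 with j^n·m ∈ N, or for every i ∈ I_h there exists n ≥ 1 with i^n·m ∈ N, or (j·i)·M ⊆ N for all j ∈ J_g and i ∈ I_h. -/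
theorem stmt1 {G R M : Type*} [AddCommGroup G] [DecidableEq G] [CommRing R]
    [AddCommGroup M] [Module R M] (𝒜 : G → AddSubgroup R) (ℳ : G → AddSubgroup M)
    [GradedRing 𝒜] [DirectSum.Decomposition ℳ] [SetLike.GradedSMul 𝒜 ℳ]
    (N : Submodule R M) (hN : IsGradedG2Absorbing 𝒜 ℳ N)
    (J I : Ideal R) (hJ : Ideal.IsHomogeneous 𝒜 J) (hI : Ideal.IsHomogeneous 𝒜 I)
    (m : M) (hm : SetLike.IsHomogeneousElem ℳ m) (g h : G)
    (hmul : ∀ j ∈ J, j ∈ 𝒜 g → ∀ i ∈ I, i ∈ 𝒜 h → j • i • m ∈ N) :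
    (∀ j ∈ J, j ∈ 𝒜 g → ∃ n : ℕ, 1 ≤ n ∧ j ^ n • m ∈ N) ∨
      (∀ i ∈ I, i ∈ 𝒜 h → ∃ n : ℕ, 1 ≤ n ∧ i ^ n • m ∈ N) ∨
      (∀ j ∈ J, j ∈ 𝒜 g → ∀ i ∈ I, i ∈ 𝒜 h → ∀ x : M, (j * i) • x ∈ N) := by
  classical
  obtain ⟨-, -, hab⟩ := hN
  let K : Ideal R := Ideal.radical (Submodule.comap (LinearMap.toSpanSingleton R M m) N)
  have hK : ∀ r : R, r ∈ K ↔ ∃ n : ℕ, 1 ≤ n ∧ r ^ n • m ∈ N := by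
    intro r
    constructor
    · rintro ⟨n, hn⟩
      have hn' : r ^ n • m ∈ N := hn
      refine ⟨n + 1, by omega, ?_⟩
      rw [pow_succ', mul_smul]
      exact N.smul_mem _ hn'
    · rintro ⟨n, -, hn⟩
      exact ⟨n, hn⟩
  simp only [← hK]
  by_contra! hcon
  obtain ⟨⟨a, haJ, hag, haK⟩, ⟨b, hbI, hbh, hbK⟩, j, hj, hjg, i, hi, hih, x, hx⟩ := hcon
  have key : ∀ j ∈ J, j ∈ 𝒜 g → j ∉ K → ∀ i ∈ I, i ∈ 𝒜 h → i ∉ K →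
      ∀ x : M, (j * i) • x ∈ N := by
    intro j hj hjg hjK i hi hih hiK
    have h3 := hab j i ⟨g, hjg⟩ ⟨h, hih⟩ m hm (hmul j hj hjg i hi hih)
    rw [← hK, ← hK] at h3
    tauto
  have key2 : ∀ j ∈ J, j ∈ 𝒜 g → ∀ i ∈ I, i ∈ 𝒜 h → i ∉ K →
      ∀ x : M, (j * i) • x ∈ N := by
    intro j hj hjg i hi hih hiK x
    by_cases hjK : j ∈ K
    · have h1 := key (j + a) (J.add_mem hj haJ) (add_mem hjg hag)
        (fun hc => haK ((K.add_mem_iff_right hjK).1 hc)) i hi hih hiK x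
      have h2 := key a haJ hag haK i hi hih hiK x
      have h4 := N.sub_mem h1 h2
      rwa [← sub_smul, ← sub_mul, add_sub_cancel_right] at h4
    · exact key j hj hjg hjK i hi hih hiK x
  apply hx
  by_cases hiK : i ∈ K
  · have h1 := key2 j hj hjg (i + b) (I.add_mem hi hbI) (add_mem hih hbh)
      (fun hc => hbK ((K.add_mem_iff_right hiK).1 hc)) x
    have h2 := key2 j hj hjg b hbI hbh hbK x
    have h4 := N.sub_mem h1 h2
    rwa [← sub_smul, ← mul_sub, add_sub_cancel_right] at h4
  · exact key2 j hj hjg i hi hih hiK x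
end

section
/- Let S be a multiplicatively closed subset of R consisting of homogeneous elements such that no element of S is a graded zero-divisor on M/N (i.e. for all s ∈ S and all homogeneous m ∈ M, s·m ∈ N implies m ∈ N). If S⁻¹N is a graded generalized 2-absorbing submodule of S⁻¹M, i.e. S⁻¹N is proper in S⁻¹M and for all homogeneous r, s ∈ R, homogeneous m ∈ M and s₁, s₂, s₃ ∈ S, (r/s₁)·(s/s₂)·(m/s₃) ∈ S⁻¹N implies (r/s₁)^k·(m/s₃) ∈ S⁻¹N for some k ≥ 1 or (s/s₂)^k·(m/s₃) ∈ S⁻¹N for some k ≥ 1 or (r/s₁)·(s/s₂)·(S⁻¹M) ⊆ S⁻¹N, then N is a graded generalized 2-absorbing (graded G2-absorbing) submodule of M. -/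
theorem stmt7 {G R M : Type*} [AddCommGroup G] [DecidableEq G] [CommRing R]
    [AddCommGroup M] [Module R M] (𝒜 : G → AddSubgroup R) (ℳ : G → AddSubgroup M)
    [GradedRing 𝒜] [DirectSum.Decomposition ℳ] [SetLike.GradedSMul 𝒜 ℳ]
    (S : Submonoid R) (hS : ∀ s ∈ S, SetLike.IsHomogeneousElem 𝒜 s)
    (N : Submodule R M) (hNgr : Submodule.IsGradedSub ℳ N)
    (hreg : ∀ s ∈ S, ∀ m : M, SetLike.IsHomogeneousElem ℳ m → s • m ∈ N → m ∈ N)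
    (hproper : N.localized S ≠ ⊤)
    (hloc : ∀ r s : R, SetLike.IsHomogeneousElem 𝒜 r → SetLike.IsHomogeneousElem 𝒜 s →
      ∀ m : M, SetLike.IsHomogeneousElem ℳ m → ∀ s₁ s₂ s₃ : S,
        (Localization.mk r s₁ * Localization.mk s s₂) • LocalizedModule.mk m s₃ ∈
            N.localized S →
          (∃ k : ℕ, 1 ≤ k ∧
              (Localization.mk r s₁) ^ k • LocalizedModule.mk m s₃ ∈ N.localized S) ∨
          (∃ k : ℕ, 1 ≤ k ∧
              (Localization.mk s s₂) ^ k • LocalizedModule.mk m s₃ ∈ N.localized S) ∨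
          ∀ x : LocalizedModule S M,
            (Localization.mk r s₁ * Localization.mk s s₂) • x ∈ N.localized S) :
    IsGradedG2Absorbing 𝒜 ℳ N := by
  have key : ∀ m : M, SetLike.IsHomogeneousElem ℳ m → ∀ t : S,
      LocalizedModule.mk m t ∈ N.localized S → m ∈ N := by
    intro m hm t h
    rw [Submodule.localized, Submodule.mem_localized'] at h
    obtain ⟨n, hn, u, h⟩ := h
    rw [← IsLocalizedModule.mk_eq_mk', LocalizedModule.mk_eq] at h
    obtain ⟨v, h⟩ := h
    refine hreg (v * u) (v * u).2 m hm ?_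
    have h2 : ((v * u : S) : R) • m = (v : R) • (t : R) • n ∨
        ((v * t : S) : R) • n = (v : R) • (u : R) • m := by
      simp only [Submonoid.smul_def] at h
      first
        | exact Or.inl (by rw [Submonoid.coe_mul, mul_smul]; exact h)
        | exact Or.inl (by rw [Submonoid.coe_mul, mul_smul]; exact h.symm)
    rcases h2 with h2 | h2
    · rw [Submonoid.coe_mul] at h2
      rw [h2]; exact N.smul_mem _ (N.smul_mem _ hn)
    · rw [mul_smul, ← h2]; exact N.smul_mem _ hn
  have hmk : ∀ n ∈ N, ∀ t : S, LocalizedModule.mk n t ∈ N.localized S := by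
    intro n hn t
    rw [Submodule.localized, Submodule.mem_localized']
    exact ⟨n, hn, t, (IsLocalizedModule.mk_eq_mk' _ _).symm⟩
  have hsm : ∀ a : R, SetLike.IsHomogeneousElem 𝒜 a → ∀ m : M,
      SetLike.IsHomogeneousElem ℳ m → SetLike.IsHomogeneousElem ℳ (a • m) := by
    rintro a ⟨i, hi⟩ m ⟨j, hj⟩
    exact ⟨i +ᵥ j, SetLike.GradedSMul.smul_mem hi hj⟩
  have hpow : ∀ a : R, SetLike.IsHomogeneousElem 𝒜 a → ∀ k : ℕ,
      SetLike.IsHomogeneousElem 𝒜 (a ^ k) := by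
    rintro a ⟨i, hi⟩ k
    exact ⟨k • i, SetLike.pow_mem_graded k hi⟩
  refine ⟨?_, hNgr, ?_⟩
  · rintro rfl
    apply hproper
    rw [eq_top_iff]
    intro x _
    induction x using LocalizedModule.induction_on with
    | h m t => exact hmk m trivial t
  · intro r s hr hs m hm h
    rcases hloc r s hr hs m hm 1 1 1 (by
      rw [Localization.mk_mul, LocalizedModule.mk_smul_mk, mul_smul]
      exact hmk _ h _) with ⟨k, hk, h⟩ | ⟨k, hk, h⟩ | h
    · left
      refine ⟨k, hk, ?_⟩
      rw [Localization.mk_pow, LocalizedModule.mk_smul_mk] at h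
      exact key _ (hsm _ (hpow r hr k) _ hm) _ h
    · right; left
      refine ⟨k, hk, ?_⟩
      rw [Localization.mk_pow, LocalizedModule.mk_smul_mk] at h
      exact key _ (hsm _ (hpow s hs k) _ hm) _ h
    · right; right
      intro x
      classical
      rw [← DirectSum.sum_support_decompose ℳ x, Finset.smul_sum]
      refine N.sum_mem fun g _ => ?_
      have h' := h (LocalizedModule.mk (DirectSum.decompose ℳ x g : M) 1)
      rw [Localization.mk_mul, LocalizedModule.mk_smul_mk] at h'
      refine key _ ?_ _ h'
      rw [mul_smul]
      exact hsm _ hr _ (hsm _ hs _ ⟨g, SetLike.coe_mem _⟩)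
end
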